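/- Let f, c_1,…,c_m : ℝⁿ → ℝ be continuously differentiable with ∇f L-Lipschitz and each ∇c_i L_i-Lipschitz (L, L_i > 0), and suppose f is bounded below on the feasible set {x : c_i(x) ≤ 0 ∀i}. Let (α_k)_{k≥0} ⊆ (0,1] satisfy Σ_k α_k = +∞ and Σ_k α_k² < +∞. Let x₀ satisfy c_i(x₀) < 0 for all i, and for each k define H_k := (Σ_{i=1}^m L_i/(−c_i(x_k)))·I + Σ_{i=1}^m ∇c_i(x_k)∇c_i(x_k)ᵀ/c_i(x_k)², let p_k attain the minimum of p ↦ f(x_k) + ∇f(x_k)ᵀp + (L/2)‖p‖² over the Dikin ellipsoid {p ∈ ℝⁿ : pᵀH_kp ≤ 1}, and set x_{k+1} := x_k + α_k p_k. Suppose x_k converges to some x* as k → ∞, and suppose the gradients {∇c_i(x*) : i with c_i(x*) = 0} are linearly independent. Then c_i(x*) ≤ 0 for all i and there exists λ* ∈ ℝ^m such that ∇f(x*) + Σ_{i=1}^m λ*_i ∇c_i(x*) = 0 and λ*_i·c_i(x*) = 0 for all i = 1,…,m. -/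

import Mathlib

open scoped RealInnerProductSpace
open Real Set Filter

open scoped Topology

/-- The quadratic upper bound for a function whose gradient is `L`-Lipschitz. -/
theorem le_quadratic_of_lipschitz_gradient {V : Type*} [NormedAddCommGroup V]
    [InnerProductSpace ℝ V] [CompleteSpace V] {f : V → ℝ} {f' : V → V} {L : ℝ}
    (hf : ∀ x, HasGradientAt f (f' x) x)
    (hL : ∀ x y, ‖f' x - f' y‖ ≤ L * ‖x - y‖) (x d : V) :
    f (x + d) ≤ f x + ⟪f' x, d⟫ + L / 2 * ‖d‖ ^ 2 := by
  have hder : ∀ t : ℝ, HasDerivAt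
      (fun t : ℝ => f (x + t • d) - t * ⟪f' x, d⟫ - L / 2 * t ^ 2 * ‖d‖ ^ 2)
      (⟪f' (x + t • d), d⟫ - ⟪f' x, d⟫ - L * t * ‖d‖ ^ 2) t := by
    intro t
    have h1 : HasDerivAt (fun t : ℝ => x + t • d) d t := by
      simpa using ((hasDerivAt_id t).smul_const d).const_add x
    have h2 := (hf (x + t • d)).hasFDerivAt.comp_hasDerivAt t h1
    have h3 : HasDerivAt (fun t : ℝ => t * ⟪f' x, d⟫) ⟪f' x, d⟫ t := by
      simpa using (hasDerivAt_id t).mul_const ⟪f' x, d⟫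
    have h4 : HasDerivAt (fun t : ℝ => L / 2 * t ^ 2 * ‖d‖ ^ 2) (L * t * ‖d‖ ^ 2) t := by
      have := (((hasDerivAt_id t).pow 2).const_mul (L / 2)).mul_const (‖d‖ ^ 2)
      refine this.congr_deriv ?_
      simp only [id, Nat.cast_ofNat]
      ring
    exact (h2.sub h3).sub h4
  have hanti : AntitoneOn
      (fun t : ℝ => f (x + t • d) - t * ⟪f' x, d⟫ - L / 2 * t ^ 2 * ‖d‖ ^ 2) (Icc 0 1) := by
    refine antitoneOn_of_deriv_nonpos (convex_Icc 0 1)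
      (fun t _ => (hder t).continuousAt.continuousWithinAt)
      (fun t _ => (hder t).differentiableAt.differentiableWithinAt) ?_
    intro t ht
    rw [interior_Icc] at ht
    rw [(hder t).deriv, ← inner_sub_left]
    have h1 := real_inner_le_norm (f' (x + t • d) - f' x) d
    have h2 := hL (x + t • d) x
    rw [add_sub_cancel_left, norm_smul, Real.norm_of_nonneg ht.1.le] at h2
    nlinarith [mul_le_mul_of_nonneg_right h2 (norm_nonneg d)]
  have h := hanti (left_mem_Icc.2 zero_le_one) (right_mem_Icc.2 zero_le_one) zero_le_one
  simp only [one_smul, zero_smul, add_zero] at h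
  linarith

/-- A real quadratic `b t + a t²` that is nonnegative for small `t > 0` has `b ≥ 0`. -/
theorem nonneg_of_eventually_quadratic_nonneg {a b : ℝ}
    (h : ∀ᶠ t in 𝓝[>] (0 : ℝ), 0 ≤ t * b + t ^ 2 * a) : 0 ≤ b := by
  have hlim : Tendsto (fun t : ℝ => b + t * a) (𝓝[>] 0) (𝓝 b) := by
    have : Continuous fun t : ℝ => b + t * a := by fun_prop
    simpa using (this.tendsto 0).mono_left nhdsWithin_le_nhds
  refine ge_of_tendsto hlim ?_
  filter_upwards [h, self_mem_nhdsWithin] with t ht htpos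
  have htpos : 0 < t := htpos
  refine nonneg_of_mul_nonneg_right ?_ htpos
  linarith [show t * (b + t * a) = t * b + t ^ 2 * a by ring]

/-- Karush–Kuhn–Tucker conditions for minimizing `⟪g, ·⟫ + L/2 ‖·‖²` subject to `Q ≤ 1`, where `Q`
is a quadratic form with gradient `2u` at the minimizer `p`. -/
theorem exists_multiplier_of_min_quadratic {V : Type*} [NormedAddCommGroup V]
    [InnerProductSpace ℝ V] {g p u : V} {L : ℝ} {Q : V → ℝ}
    (hQ : ∀ (d : V) (t : ℝ), Q (p + t • d) = Q p + 2 * t * ⟪u, d⟫ + t ^ 2 * Q d)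
    (hup : ⟪u, p⟫ = Q p) (hp : Q p ≤ 1)
    (hmin : ∀ q, Q q ≤ 1 → ⟪g, p⟫ + L / 2 * ‖p‖ ^ 2 ≤ ⟪g, q⟫ + L / 2 * ‖q‖ ^ 2) :
    ∃ μ : ℝ, 0 ≤ μ ∧ g + L • p + μ • u = 0 ∧ μ * Q p = μ := by
  set G := g + L • p with hG
  have key : ∀ d : V, (∀ᶠ t in 𝓝[>] (0 : ℝ), Q (p + t • d) ≤ 1) → 0 ≤ ⟪G, d⟫ := by
    intro d hd
    refine nonneg_of_eventually_quadratic_nonneg (a := L / 2 * ‖d‖ ^ 2) ?_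
    filter_upwards [hd] with t ht
    have h := hmin _ ht
    rw [norm_add_sq_real, inner_add_right, inner_smul_right, inner_smul_right, norm_smul,
      mul_pow, Real.norm_eq_abs, sq_abs] at h
    rw [hG, inner_add_left, real_inner_smul_left]
    linarith
  rcases hp.lt_or_eq with hlt | heq
  · have hfree : ∀ d : V, 0 ≤ ⟪G, d⟫ := by
      intro d
      refine key d ?_
      have hc : Continuous fun t : ℝ => Q p + 2 * t * ⟪u, d⟫ + t ^ 2 * Q d := by fun_prop
      have := (hc.tendsto 0).mono_left (nhdsWithin_le_nhds (s := Ioi 0))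
      filter_upwards [this.eventually_lt_const (u := 1) (by simpa using hlt)] with t ht
      rw [hQ]
      exact ht.le
    refine ⟨0, le_rfl, ?_, by simp⟩
    have := hfree (-G)
    rw [inner_neg_right, real_inner_self_eq_norm_sq] at this
    have h0 : ‖G‖ = 0 := by nlinarith [sq_nonneg ‖G‖]
    simpa using h0
  · have hstrict : ∀ d : V, ⟪u, d⟫ < 0 → 0 ≤ ⟪G, d⟫ := by
      intro d hd
      refine key d ?_
      have hc : Continuous fun t : ℝ => 2 * ⟪u, d⟫ + t * Q d := by fun_prop
      have := (hc.tendsto 0).mono_left (nhdsWithin_le_nhds (s := Ioi 0))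
      filter_upwards [this.eventually_lt_const (u := 0) (by simpa using (by linarith : 2 * ⟪u, d⟫ < 0)),
        self_mem_nhdsWithin] with t ht htpos
      have htpos : 0 < t := htpos
      rw [hQ, heq]
      nlinarith
    have hu : 0 < ‖u‖ ^ 2 := by
      have : u ≠ 0 := by
        rintro rfl
        simp [heq] at hup
      positivity
    have hGu : ⟪G, u⟫ ≤ 0 := by
      have := hstrict (-u) (by rw [inner_neg_right, real_inner_self_eq_norm_sq]; linarith)
      rw [inner_neg_right] at this
      linarith
    set μ := -⟪G, u⟫ / ‖u‖ ^ 2 with hμ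
    have hμu : μ * ‖u‖ ^ 2 = -⟪G, u⟫ := div_mul_cancel₀ _ hu.ne'
    refine ⟨μ, div_nonneg (by linarith) hu.le, ?_, by rw [heq, mul_one]⟩
    set r := G + μ • u with hr
    have hur : ⟪u, r⟫ = 0 := by
      rw [hr, inner_add_right, inner_smul_right, real_inner_self_eq_norm_sq, hμu,
        real_inner_comm]
      ring
    have hGr : ⟪G, r⟫ = ‖r‖ ^ 2 := by
      have : G = r - μ • u := by rw [hr]; abel
      conv_lhs => rw [this]
      rw [inner_sub_left, real_inner_smul_left, hur, real_inner_self_eq_norm_sq]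
      ring
    have hle : ∀ᶠ ε in 𝓝[>] (0 : ℝ), ε * ⟪G, u⟫ ≤ -‖r‖ ^ 2 := by
      filter_upwards [self_mem_nhdsWithin] with ε hε
      have hε : 0 < ε := hε
      have := hstrict (-r - ε • u) (by
        rw [inner_sub_right, inner_neg_right, inner_smul_right, hur, real_inner_self_eq_norm_sq]
        nlinarith)
      rw [inner_sub_right, inner_neg_right, inner_smul_right, hGr] at this
      linarith
    have hlim : Tendsto (fun ε : ℝ => ε * ⟪G, u⟫) (𝓝[>] 0) (𝓝 0) := by
      have : Continuous fun ε : ℝ => ε * ⟪G, u⟫ := by fun_prop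
      simpa using (this.tendsto 0).mono_left nhdsWithin_le_nhds
    have := le_of_tendsto hlim hle
    have h0 : ‖r‖ = 0 := by nlinarith [sq_nonneg ‖r‖]
    simpa using h0

/-- Linear independence is quantitatively stable under convergence of finite families. -/
theorem LinearIndependent.exists_eventually_le_norm_sum {V ι : Type*} [NormedAddCommGroup V]
    [NormedSpace ℝ V] [Fintype ι] {v : ι → V} (hv : LinearIndependent ℝ v)
    {u : ℕ → ι → V} (hu : ∀ i, Tendsto (fun k => u k i) atTop (𝓝 (v i))) :
    ∃ κ : ℝ, 0 < κ ∧ ∀ᶠ k in atTop, ∀ l : ι → ℝ, κ * ‖l‖ ≤ ‖∑ i, l i • u k i‖ := by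
  obtain ⟨K, hK, hanti⟩ := (Fintype.linearCombination ℝ v).exists_antilipschitzWith
    (LinearMap.ker_eq_bot.2 hv.fintypeLinearCombination_injective)
  have hK : (0 : ℝ) < K := hK
  have hlow : ∀ l : ι → ℝ, ‖l‖ ≤ K * ‖∑ i, l i • v i‖ := by
    intro l
    simpa [Fintype.linearCombination_apply] using hanti.le_mul_dist l 0
  have hsum : Tendsto (fun k => ∑ i, ‖u k i - v i‖) atTop (𝓝 0) := by
    have : ∀ i ∈ Finset.univ, Tendsto (fun k => ‖u k i - v i‖) atTop (𝓝 0) := fun i _ =>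
      tendsto_iff_norm_sub_tendsto_zero.1 (hu i)
    simpa using tendsto_finsetSum _ this
  refine ⟨1 / (2 * K), by positivity, ?_⟩
  filter_upwards [hsum.eventually_le_const (u := 1 / (2 * (K : ℝ))) (by positivity)] with k hk l
  have hdiff : ‖∑ i, l i • (v i - u k i)‖ ≤ ‖l‖ * (1 / (2 * K)) := by
    calc ‖∑ i, l i • (v i - u k i)‖ ≤ ∑ i, ‖l i • (v i - u k i)‖ := norm_sum_le _ _
      _ ≤ ∑ i, ‖l‖ * ‖u k i - v i‖ := by
        refine Finset.sum_le_sum fun i _ => ?_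
        rw [norm_smul, norm_sub_rev]
        gcongr
        exact norm_le_pi_norm l i
      _ ≤ ‖l‖ * (1 / (2 * K)) := by
        rw [← Finset.mul_sum]
        gcongr
  have hsplit : ∑ i, l i • v i = ∑ i, l i • u k i + ∑ i, l i • (v i - u k i) := by
    rw [← Finset.sum_add_distrib]
    simp [smul_sub]
  have h1 := hlow l
  have h2 := norm_add_le (∑ i, l i • u k i) (∑ i, l i • (v i - u k i))
  rw [← hsplit] at h2
  have h3 : ‖l‖ / K ≤ ‖∑ i, l i • v i‖ := by
    rw [div_le_iff₀ hK]
    linarith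
  have h4 : ‖l‖ / K = 1 / (2 * K) * ‖l‖ + ‖l‖ * (1 / (2 * K)) := by
    field_simp
    ring
  linarith

/-- A sequence growing by factors `1 + ε k` with `ε` summable is bounded. -/
theorem exists_bound_of_le_mul_one_add {E ε : ℕ → ℝ} {N : ℕ} (hE : ∀ k, 0 ≤ E k)
    (hε : ∀ k, 0 ≤ ε k) (hsum : Summable ε)
    (hstep : ∀ k, N ≤ k → E (k + 1) ≤ E k * (1 + ε k)) :
    ∃ B : ℝ, ∀ k, N ≤ k → E k ≤ B := by
  have hexp : ∀ k, N ≤ k → E k ≤ E N * Real.exp (∑ j ∈ Finset.range k, ε j) := by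
    intro k hk
    induction k, hk using Nat.le_induction with
    | base =>
      exact le_mul_of_one_le_right (hE N) (Real.one_le_exp (Finset.sum_nonneg fun j _ => hε j))
    | succ k hk ih =>
      rw [Finset.sum_range_succ, Real.exp_add, ← mul_assoc]
      refine (hstep k hk).trans (mul_le_mul ih ?_ (by linarith [hε k])
        (mul_nonneg (hE N) (Real.exp_pos _).le))
      linarith [Real.add_one_le_exp (ε k)]
  refine ⟨E N * Real.exp (∑' j, ε j), fun k hk => (hexp k hk).trans ?_⟩
  refine mul_le_mul_of_nonneg_left (Real.exp_le_exp.2 ?_) (hE N)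
  exact hsum.sum_le_tsum _ fun j _ => hε j

/-- A step of length `t ≤ 1` inside the Dikin ellipsoid keeps the constraint `c < 0`, and for
`t ≤ 1/4` the reciprocal slack grows at most by the stated factor. -/
theorem slack_of_dikin_step {V : Type*} [NormedAddCommGroup V]
    [InnerProductSpace ℝ V] [CompleteSpace V] {c : V → ℝ} {c' : V → V} {K t : ℝ} {x p : V}
    (hc : ∀ x, HasGradientAt c (c' x) x) (hK : 0 < K)
    (hlip : ∀ x y, ‖c' x - c' y‖ ≤ K * ‖x - y‖) (hx : c x < 0) (ht0 : 0 < t) (ht1 : t ≤ 1)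
    (hp : K / (-c x) * ‖p‖ ^ 2 + ⟪c' x, p⟫ ^ 2 / c x ^ 2 ≤ 1) :
    c (x + t • p) < 0 ∧ (t ≤ 1 / 4 → K / (-c (x + t • p)) ≤
      K / (-c x) * (1 + 2 * t * |⟪c' x, p⟫ / (-c x)| + t ^ 2)) := by
  have hdesc := le_quadratic_of_lipschitz_gradient hc hlip x (t • p)
  rw [inner_smul_right, norm_smul, mul_pow, Real.norm_eq_abs, sq_abs] at hdesc
  obtain ⟨s, hs⟩ : ∃ s, s = -c x := ⟨_, rfl⟩
  have hspos : 0 < s := by linarith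
  rw [← hs, show c x = -s by linarith, neg_sq, ← div_pow] at hp
  rw [← hs]
  set a := ⟪c' x, p⟫ / s with ha
  set b := K / s * ‖p‖ ^ 2 with hb
  have hb0 : 0 ≤ b := by positivity
  have has : ⟪c' x, p⟫ = a * s := by rw [ha]; field_simp
  have hbs : K * ‖p‖ ^ 2 = b * s := by rw [hb]; field_simp
  have hnew : s * (1 - t * a - t ^ 2 * b / 2) ≤ -c (x + t • p) := by
    rw [has] at hdesc
    have : K / 2 * (t ^ 2 * ‖p‖ ^ 2) = t ^ 2 * (b * s) / 2 := by rw [← hbs]; ring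
    rw [this] at hdesc
    linarith
  have ha1 : a < 1 := by
    by_contra! h
    have hb' : b = 0 := by nlinarith
    have hp0 : ‖p‖ = 0 := by
      rw [hb'] at hbs
      have : ‖p‖ ^ 2 = 0 := by nlinarith [sq_nonneg ‖p‖]
      simpa using this
    rw [norm_eq_zero] at hp0
    rw [ha, hp0] at h
    norm_num at h
  have hab1 : |a| ≤ 1 := abs_le_one_iff_mul_self_le_one.2 (by nlinarith)
  constructor
  · have hta : t * a < 1 := by
      rcases le_or_gt a 0 with h | h <;> nlinarith
    have : 0 < 1 - t * a - t ^ 2 * b / 2 := by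
      have h1 : t ^ 2 * b ≤ t ^ 2 * (1 - a ^ 2) :=
        mul_le_mul_of_nonneg_left (by linarith) (sq_nonneg t)
      have h2 : t ^ 2 ≤ 1 := pow_le_one₀ ht0.le ht1
      have h3 : 0 < (1 - t * a) ^ 2 := pow_pos (by linarith) 2
      nlinarith
    have := mul_pos hspos this
    linarith
  · intro ht4
    set w := t * |a| + t ^ 2 / 2 with hw
    have hw0 : 0 ≤ w := by positivity
    have hw1 : w ≤ 1 / 2 := by nlinarith [abs_nonneg a]
    have hz : 1 - w ≤ 1 - t * a - t ^ 2 * b / 2 := by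
      have h1 := mul_le_mul_of_nonneg_left (le_abs_self a) ht0.le
      have h2 : t ^ 2 * b ≤ t ^ 2 * 1 :=
        mul_le_mul_of_nonneg_left (by nlinarith [sq_nonneg a]) (sq_nonneg t)
      linarith
    have hlow : s * (1 - w) ≤ -c (x + t • p) :=
      (mul_le_mul_of_nonneg_left hz hspos.le).trans hnew
    have hpos : 0 < s * (1 - w) := mul_pos hspos (by linarith)
    calc K / (-c (x + t • p)) ≤ K / (s * (1 - w)) := by gcongr
      _ = K / s * (1 / (1 - w)) := by
        have : (1 - w) ≠ 0 := by linarith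
        field_simp
      _ ≤ K / s * (1 + 2 * t * |a| + t ^ 2) := by
        gcongr
        rw [div_le_iff₀ (by linarith), show 1 + 2 * t * |a| + t ^ 2 = 1 + 2 * w by rw [hw]; ring]
        nlinarith

/-- Bounds on the Lagrange multipliers of the Dikin subproblem when the active constraint gradients
and the objective gradient are quantitatively linearly independent. -/
theorem dikin_multiplier_bounds {V : Type*} [NormedAddCommGroup V]
    [InnerProductSpace ℝ V] {m : ℕ} {P : Fin m → Prop} [DecidablePred P] {g p : V}
    {a : Fin m → V} {S : Fin m → ℝ} {L μ D κ M σ : ℝ} (hL : 0 < L) (hμ : 0 ≤ μ)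
    (hD : 0 ≤ D) (hκ : 0 < κ) (hσ : 0 < σ) (hS : ∀ i, 0 < S i) (hDp : D * ‖p‖ ^ 2 ≤ 1)
    (hA : ∀ i, |⟪a i, p⟫ / S i| ≤ 1)
    (heq : g + L • p + μ • (D • p + ∑ i, (⟪a i, p⟫ / S i ^ 2) • a i) = 0)
    (hgp : ⟪g, p⟫ = -L * ‖p‖ ^ 2 - μ)
    (hind : ∀ l : Option {i // P i} → ℝ,
      κ * ‖l‖ ≤ ‖∑ o, l o • o.elim g (fun i => a i)‖)
    (hg : ‖g‖ ≤ M) (ha : ∀ i, ‖a i‖ ≤ M) (hPS : ∀ i, ¬ P i → σ ≤ S i) :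
    κ ≤ L * ‖p‖ + (1 + m * (M / σ)) * μ * √(1 + D) ∧
    ∀ i, μ * (|⟪a i, p⟫ / S i| / S i) ≤
      (M + m * (M / σ) * (M ^ 2 / L)) / κ + M ^ 2 / L / σ := by
  have hM : 0 ≤ M := (norm_nonneg g).trans hg
  have hgp' : L * ‖p‖ ^ 2 + μ ≤ M * ‖p‖ := by
    have h1 := neg_le_of_abs_le (abs_real_inner_le_norm g p)
    have h2 := mul_le_mul_of_nonneg_right hg (norm_nonneg p)
    linarith
  have hT : (L + μ * D) * ‖p‖ ≤ M := by
    rcases (norm_nonneg p).eq_or_lt with h | h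
    · rw [← h]; simpa using hM
    · refine le_of_mul_le_mul_right ?_ h
      have := mul_le_mul_of_nonneg_left hDp hμ
      nlinarith
  have hLp : L * ‖p‖ ≤ M := by
    have : 0 ≤ μ * D * ‖p‖ := by positivity
    linarith
  have hμM : μ ≤ M ^ 2 / L := by
    rw [le_div_iff₀ hL]
    have h1 : μ ≤ M * ‖p‖ := by
      have : 0 ≤ L * ‖p‖ ^ 2 := by positivity
      linarith
    nlinarith [mul_le_mul_of_nonneg_left hLp hM]
  set lam : Fin m → ℝ := fun i => μ * (⟪a i, p⟫ / S i ^ 2) with hlam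
  have habs : ∀ i, |lam i| = μ * (|⟪a i, p⟫ / S i| / S i) := by
    intro i
    have : ⟪a i, p⟫ / S i ^ 2 = ⟪a i, p⟫ / S i / S i := by rw [div_div, sq]
    rw [hlam]
    simp only
    rw [this, abs_mul, abs_of_nonneg hμ, abs_div (⟪a i, p⟫ / S i), abs_of_pos (hS i)]
  have hinact : ∀ i, ¬ P i → |lam i| ≤ μ / σ := by
    intro i hi
    rw [habs, ← mul_one_div μ σ]
    gcongr
    · exact hA i
    · exact hPS i hi
  set l : Option {i // P i} → ℝ := fun o => o.elim 1 (fun i => lam i) with hl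
  have hcomb : ∑ o, l o • o.elim g (fun i => a i) =
      -((L + μ * D) • p + ∑ i : {i // ¬ P i}, lam i • a i) := by
    have h1 := Fintype.sum_subtype_add_sum_subtype P (fun i => lam i • a i)
    rw [smul_add, Finset.smul_sum] at heq
    simp only [smul_smul] at heq
    rw [Fintype.sum_option]
    simp only [hl, Option.elim_none, Option.elim_some, one_smul]
    rw [eq_neg_iff_add_eq_zero, ← heq, ← h1, add_smul]
    abel
  have hNbd : ‖∑ i : {i // ¬ P i}, lam i • a i‖ ≤ m * (M / σ) * μ := by
    calc ‖∑ i : {i // ¬ P i}, lam i • a i‖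
        ≤ ∑ i : {i // ¬ P i}, μ / σ * M := by
          refine (norm_sum_le _ _).trans (Finset.sum_le_sum fun i _ => ?_)
          rw [norm_smul, Real.norm_eq_abs]
          exact mul_le_mul (hinact i i.2) (ha i) (norm_nonneg _) (by positivity)
      _ = (Fintype.card {i // ¬ P i} : ℝ) * (μ / σ * M) := by simp
      _ ≤ (m : ℝ) * (μ / σ * M) := by
        gcongr
        simp
      _ = m * (M / σ) * μ := by ring
  have hmain : κ * ‖l‖ ≤ (L + μ * D) * ‖p‖ + m * (M / σ) * μ := by
    refine (hind l).trans ?_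
    rw [hcomb, norm_neg]
    refine (norm_add_le _ _).trans (add_le_add ?_ hNbd)
    rw [norm_smul, Real.norm_of_nonneg (by positivity)]
  have hl1 : 1 ≤ ‖l‖ := by simpa [hl] using norm_le_pi_norm l none
  have hN : 0 ≤ m * (M / σ) := by positivity
  constructor
  · have hr0 : 0 ≤ √(1 + D) := Real.sqrt_nonneg _
    have hr1 : 1 ≤ √(1 + D) := Real.one_le_sqrt.2 (by linarith)
    have hr2 : √(1 + D) ^ 2 = 1 + D := Real.sq_sqrt (by linarith)
    have hDr : D * ‖p‖ ≤ √(1 + D) := by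
      refine le_of_sq_le_sq ?_ hr0
      rw [hr2]
      nlinarith
    have h1 : κ ≤ κ * ‖l‖ := le_mul_of_one_le_right hκ.le hl1
    have h2 := mul_le_mul_of_nonneg_left hDr hμ
    have h3 : m * (M / σ) * μ * 1 ≤ m * (M / σ) * μ * √(1 + D) := by gcongr
    nlinarith
  · intro i
    rw [← habs]
    have hT1 : 0 ≤ (M + m * (M / σ) * (M ^ 2 / L)) / κ := by positivity
    have hT2 : 0 ≤ M ^ 2 / L / σ := by positivity
    by_cases hi : P i
    · have h1 : |lam i| ≤ ‖l‖ := by simpa [hl] using norm_le_pi_norm l (some ⟨i, hi⟩)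
      have h2 : ‖l‖ ≤ (M + m * (M / σ) * (M ^ 2 / L)) / κ := by
        rw [le_div_iff₀ hκ]
        have := mul_le_mul_of_nonneg_left hμM hN
        linarith
      linarith
    · have := hinact i hi
      have h2 : μ / σ ≤ M ^ 2 / L / σ := by gcongr
      linarith

/-- Consequences of a lower bound `κ` on the stationarity residual: a lower bound for the decrease
`μ + L/2 q²`, and a bound for the growth rate of the barrier sum `∑ Lᵢ/Sᵢ`. -/
theorem barrier_growth_bounds {m : ℕ} {Li S A : Fin m → ℝ} {L μ D κ N Λ q : ℝ} (hL : 0 < L)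
    (hμ : 0 ≤ μ) (hκ : 0 < κ) (hN : 0 ≤ N) (hΛ : 0 ≤ Λ) (hLi : ∀ i, 0 < Li i)
    (hS : ∀ i, 0 < S i) (hD : D = ∑ i, Li i / S i) (hDq : D * q ^ 2 ≤ 1) (hA : ∀ i, |A i| ≤ 1)
    (hres : κ ≤ L * q + (1 + N) * μ * √(1 + D)) (hlam : ∀ i, μ * (|A i| / S i) ≤ Λ) :
    1 / √(1 + D) ≤ (8 * L / κ ^ 2 + 2 * (1 + N) / κ) * (μ + L / 2 * q ^ 2) ∧
    ∑ i, Li i / S i * |A i| ≤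
      (2 * L / κ + (∑ i, Li i) * (Λ * (2 * (1 + N) / κ))) * √(1 + D) := by
  have hD0 : 0 ≤ D := by
    rw [hD]
    exact Finset.sum_nonneg fun i _ => (div_pos (hLi i) (hS i)).le
  have hr0 : 0 ≤ √(1 + D) := Real.sqrt_nonneg _
  have hr1 : 1 ≤ √(1 + D) := Real.one_le_sqrt.2 (by linarith)
  have hr2 : √(1 + D) ^ 2 = 1 + D := Real.sq_sqrt (by linarith)
  set r := √(1 + D)
  have hLs : 0 ≤ ∑ i, Li i := Finset.sum_nonneg fun i _ => (hLi i).le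
  have hrpos : 0 < r := by linarith
  have hrinv : 1 / r ≤ 1 := by rw [div_le_one hrpos]; exact hr1
  rcases le_or_gt (κ / 2) (L * q) with h | h
  · have hqpos : 0 < q := by
      by_contra! hq'
      nlinarith
    constructor
    · have h1 : 1 ≤ 8 * L / κ ^ 2 * (L / 2 * q ^ 2) := by
        have : 8 * L / κ ^ 2 * (L / 2 * q ^ 2) = (2 * (L * q) / κ) ^ 2 := by ring
        rw [this]
        refine one_le_pow₀ ?_
        rw [le_div_iff₀ hκ]
        linarith
      have h2 : 0 ≤ 8 * L / κ ^ 2 * μ := by positivity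
      have h3 : 0 ≤ 2 * (1 + N) / κ * (μ + L / 2 * q ^ 2) := by positivity
      linarith
    · have h1 : ∑ i, Li i / S i * |A i| ≤ D := by
        rw [hD]
        exact Finset.sum_le_sum fun i _ =>
          mul_le_of_le_one_right (div_pos (hLi i) (hS i)).le (hA i)
      have h2 : D ≤ 2 * L / κ * r := by
        have hq1 : κ / (2 * L) ≤ q := by
          rw [div_le_iff₀ (by positivity)]
          linarith
        have h4 : D * q ≤ r := by
          refine le_of_sq_le_sq ?_ hr0
          rw [hr2]
          nlinarith
        have h5 : D * (κ / (2 * L)) ≤ r := (mul_le_mul_of_nonneg_left hq1 hD0).trans h4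
        calc D = 2 * L / κ * (D * (κ / (2 * L))) := by field_simp
          _ ≤ 2 * L / κ * r := by gcongr
      have h3 : 0 ≤ (∑ i, Li i) * (Λ * (2 * (1 + N) / κ)) * r := by positivity
      linarith
  · have hμr : 1 ≤ 2 * (1 + N) / κ * (μ * r) := by
      rw [div_mul_eq_mul_div, le_div_iff₀ hκ]
      linarith
    constructor
    · have h1 : 1 / r ≤ 2 * (1 + N) / κ * μ := by
        rw [div_le_iff₀ hrpos]
        linarith
      have h2 : 0 ≤ 8 * L / κ ^ 2 * (μ + L / 2 * q ^ 2) := by positivity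
      have h3 : 0 ≤ 2 * (1 + N) / κ * (L / 2 * q ^ 2) := by positivity
      linarith
    · have h1 : ∀ i, |A i| / S i ≤ Λ * (2 * (1 + N) / κ) * r := by
        intro i
        have h0 : 0 ≤ |A i| / S i := div_nonneg (abs_nonneg _) (hS i).le
        calc |A i| / S i ≤ |A i| / S i * (2 * (1 + N) / κ * (μ * r)) :=
              le_mul_of_one_le_right h0 hμr
          _ = μ * (|A i| / S i) * (2 * (1 + N) / κ * r) := by ring
          _ ≤ Λ * (2 * (1 + N) / κ * r) :=
              mul_le_mul_of_nonneg_right (hlam i) (by positivity)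
          _ = Λ * (2 * (1 + N) / κ) * r := by ring
      have h2 : ∑ i, Li i / S i * |A i| ≤ (∑ i, Li i) * (Λ * (2 * (1 + N) / κ) * r) := by
        rw [Finset.sum_mul]
        refine Finset.sum_le_sum fun i _ => ?_
        rw [div_mul_eq_mul_div, mul_div_assoc]
        exact mul_le_mul_of_nonneg_left (h1 i) (hLi i).le
      have h3 : 0 ≤ 2 * L / κ * r := by positivity
      linarith

/-- (Theorem 8 in the paper: subsequential convergence of the
affine-scaling Algorithm CEAS with diminishing stepsizes.)  If the CEAS iterates
converge to `x*` at which LICQ holds, then `x*` is feasible and a KKT point.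
The Dikin-ellipsoid constraint `pᵀH_k p ≤ 1` is written out via the quadratic form
`(Σᵢ Lᵢ/(−cᵢ(xₖ)))‖p‖² + Σᵢ ⟨∇cᵢ(xₖ), p⟩²/cᵢ(xₖ)² ≤ 1`. -/
theorem ceas_convergence_to_kkt {n m : ℕ}
    (f : EuclideanSpace ℝ (Fin n) → ℝ)
    (c : Fin m → EuclideanSpace ℝ (Fin n) → ℝ)
    (f' : EuclideanSpace ℝ (Fin n) → EuclideanSpace ℝ (Fin n))
    (c' : Fin m → EuclideanSpace ℝ (Fin n) → EuclideanSpace ℝ (Fin n))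
    (hf : ∀ x, HasGradientAt f (f' x) x) (hf'cont : Continuous f')
    (hc : ∀ i x, HasGradientAt (c i) (c' i x) x) (hc'cont : ∀ i, Continuous (c' i))
    (L : ℝ) (Li : Fin m → ℝ) (hL : 0 < L) (hLi : ∀ i, 0 < Li i)
    (hflip : ∀ x y, ‖f' x - f' y‖ ≤ L * ‖x - y‖)
    (hclip : ∀ i x y, ‖c' i x - c' i y‖ ≤ Li i * ‖x - y‖)
    -- f is bounded below on the feasible set
    (Fstar : ℝ) (hbdd : ∀ z, (∀ i, c i z ≤ 0) → Fstar ≤ f z)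
    -- diminishing stepsizes
    (α : ℕ → ℝ) (hα : ∀ k, 0 < α k ∧ α k ≤ 1)
    (hαdiv : Tendsto (fun K => ∑ k ∈ Finset.range K, α k) atTop atTop)
    (hαsq : Summable fun k => (α k) ^ 2)
    -- Algorithm CEAS
    (x p : ℕ → EuclideanSpace ℝ (Fin n))
    (hx0 : ∀ i, c i (x 0) < 0)
    (hstep : ∀ k, x (k + 1) = x k + α k • p k)
    (hpfeas : ∀ k,
      (∑ i, Li i / (-(c i (x k)))) * ‖p k‖ ^ 2 +
        ∑ i, (⟪c' i (x k), p k⟫) ^ 2 / (c i (x k)) ^ 2 ≤ 1)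
    (hpmin : ∀ k, ∀ q : EuclideanSpace ℝ (Fin n),
      (∑ i, Li i / (-(c i (x k)))) * ‖q‖ ^ 2 +
        ∑ i, (⟪c' i (x k), q⟫) ^ 2 / (c i (x k)) ^ 2 ≤ 1 →
      f (x k) + ⟪f' (x k), p k⟫ + (L / 2) * ‖p k‖ ^ 2 ≤
        f (x k) + ⟪f' (x k), q⟫ + (L / 2) * ‖q‖ ^ 2)
    -- convergence of the iterates and LICQ at the limit
    (xstar : EuclideanSpace ℝ (Fin n))
    (hconv : Tendsto x atTop (nhds xstar))
    (hLICQ : LinearIndependent ℝ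
      (fun i : {i : Fin m // c i xstar = 0} => c' (i : Fin m) xstar)) :
    (∀ i, c i xstar ≤ 0) ∧
    ∃ lam : Fin m → ℝ,
      f' xstar + ∑ i, lam i • c' i xstar = 0 ∧ ∀ i, lam i * c i xstar = 0 := by
  classical
  have hneg : ∀ k i, c i (x k) < 0 ∧ (α k ≤ 1 / 4 →
      Li i / (-c i (x (k + 1))) ≤ Li i / (-c i (x k)) *
        (1 + 2 * α k * |⟪c' i (x k), p k⟫ / (-c i (x k))| + α k ^ 2)) := by
    have hstep' : ∀ k, (∀ i, c i (x k) < 0) → ∀ i, c i (x (k + 1)) < 0 ∧ (α k ≤ 1 / 4 →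
      Li i / (-c i (x (k + 1))) ≤ Li i / (-c i (x k)) *
        (1 + 2 * α k * |⟪c' i (x k), p k⟫ / (-c i (x k))| + α k ^ 2)) := by
      intro k hk i
      rw [hstep k]
      refine slack_of_dikin_step (hc i) (hLi i) (hclip i) (hk i) (hα k).1 (hα k).2 ?_
      refine le_trans (add_le_add ?_ ?_) (hpfeas k)
      · refine mul_le_mul_of_nonneg_right ?_ (sq_nonneg _)
        exact Finset.single_le_sum (f := fun i => Li i / (-c i (x k)))
          (fun j _ => (div_pos (hLi j) (neg_pos.2 (hk j))).le) (Finset.mem_univ i)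
      · exact Finset.single_le_sum (f := fun i => ⟪c' i (x k), p k⟫ ^ 2 / c i (x k) ^ 2)
          (fun j _ => by positivity) (Finset.mem_univ i)
    have hall : ∀ k i, c i (x k) < 0 := by
      intro k
      induction k with
      | zero => exact hx0
      | succ k ih => exact fun i => (hstep' k ih i).1
    exact fun k i => ⟨hall k i, (hstep' k (hall k) i).2⟩
  have hccont : ∀ i, Continuous (c i) := fun i =>
    continuous_iff_continuousAt.2 fun z => (hc i z).hasFDerivAt.continuousAt
  have hclim : ∀ i, Tendsto (fun k => c i (x k)) atTop (𝓝 (c i xstar)) := fun i =>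
    ((hccont i).tendsto xstar).comp hconv
  have hfeas : ∀ i, c i xstar ≤ 0 := fun i =>
    le_of_tendsto (hclim i) (Eventually.of_forall fun k => (hneg k i).1.le)
  refine ⟨hfeas, ?_⟩
  by_contra hkkt
  have hspan : f' xstar ∉ Submodule.span ℝ
      (Set.range fun i : {i : Fin m // c i xstar = 0} => c' (i : Fin m) xstar) := by
    intro hmem
    obtain ⟨β, hβ⟩ := (Submodule.mem_span_range_iff_exists_fun ℝ).1 hmem
    refine hkkt ⟨fun i => if h : c i xstar = 0 then -β ⟨i, h⟩ else 0, ?_, ?_⟩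
    · rw [← Fintype.sum_subtype_add_sum_subtype (fun i => c i xstar = 0), ← hβ]
      have h1 : ∀ i : {i : Fin m // c i xstar = 0},
          (if h : c i xstar = 0 then -β ⟨i, h⟩ else 0) • c' i xstar = -(β i • c' i xstar) := by
        intro i
        rw [dif_pos i.2, neg_smul]
      have h2 : ∀ i : {i : Fin m // ¬ c i xstar = 0},
          (if h : c i xstar = 0 then -β ⟨i, h⟩ else 0) • c' i xstar = 0 := by
        intro i
        rw [dif_neg i.2, zero_smul]
      simp only [h1, h2, Finset.sum_neg_distrib, Finset.sum_const_zero]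
      abel
    · intro i
      by_cases h : c i xstar = 0 <;> simp [h]
  have hindep := LinearIndependent.option hLICQ hspan
  have hflim : Tendsto (fun k => f' (x k)) atTop (𝓝 (f' xstar)) :=
    (hf'cont.tendsto xstar).comp hconv
  have hc'lim : ∀ i, Tendsto (fun k => c' i (x k)) atTop (𝓝 (c' i xstar)) := fun i =>
    ((hc'cont i).tendsto xstar).comp hconv
  obtain ⟨κ, hκ, hind⟩ := hindep.exists_eventually_le_norm_sum
    (u := fun k o => o.elim (f' (x k)) (fun i => c' i (x k))) (by
      rintro (_ | i)
      · simpa using hflim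
      · simpa using hc'lim i)
  obtain ⟨M, hMf, hMc⟩ : ∃ M, (∀ k, ‖f' (x k)‖ ≤ M) ∧ ∀ k i, ‖c' i (x k)‖ ≤ M := by
    have hb : ∀ o : Option (Fin m), ∃ B, ∀ k,
        ‖o.elim (f' (x k)) (fun i => c' i (x k))‖ ≤ B := by
      rintro (_ | i)
      · obtain ⟨B, hB⟩ := hflim.norm.bddAbove_range
        exact ⟨B, fun k => hB ⟨k, rfl⟩⟩
      · obtain ⟨B, hB⟩ := (hc'lim i).norm.bddAbove_range
        exact ⟨B, fun k => hB ⟨k, rfl⟩⟩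
    choose B hB using hb
    have hle : ∀ o, B o ≤ ∑ o, B o := fun o => Finset.single_le_sum (f := B)
      (fun o _ => (norm_nonneg _).trans (hB o 0)) (Finset.mem_univ o)
    exact ⟨∑ o, B o, fun k => (hB none k).trans (hle _), fun k i => (hB (some i) k).trans (hle _)⟩
  obtain ⟨σ, hσ, hinact⟩ : ∃ σ : ℝ, 0 < σ ∧
      ∀ᶠ k in atTop, ∀ i, ¬ c i xstar = 0 → σ ≤ -c i (x k) := by
    have hex : ∃ σ : ℝ, 0 < σ ∧ ∀ i, ¬ c i xstar = 0 → σ < -c i xstar := by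
      have : ∀ᶠ σ in 𝓝[>] (0 : ℝ), ∀ i, ¬ c i xstar = 0 → σ < -c i xstar := by
        refine eventually_all.2 fun i => ?_
        by_cases hi : c i xstar = 0
        · simp [hi]
        · have hpos : 0 < -c i xstar := neg_pos.2 (lt_of_le_of_ne (hfeas i) hi)
          filter_upwards [nhdsWithin_le_nhds (Iio_mem_nhds hpos)] with σ hσ _ using hσ
      obtain ⟨σ, h1, h2⟩ := (this.and self_mem_nhdsWithin).exists
      exact ⟨σ, h2, h1⟩
    obtain ⟨σ, hσ, hσi⟩ := hex
    refine ⟨σ, hσ, eventually_all.2 fun i => ?_⟩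
    by_cases hi : c i xstar = 0
    · simp [hi]
    · filter_upwards [(hclim i).neg.eventually_const_lt (hσi i hi)] with k hk _ using hk.le
  set D : ℕ → ℝ := fun k => ∑ i, Li i / (-c i (x k)) with hD
  have hLS : ∀ k i, 0 < Li i / (-c i (x k)) := fun k i =>
    div_pos (hLi i) (neg_pos.2 (hneg k i).1)
  have hD0 : ∀ k, 0 ≤ D k := fun k => Finset.sum_nonneg fun i _ => (hLS k i).le
  have hDp : ∀ k, D k * ‖p k‖ ^ 2 ≤ 1 := fun k =>
    le_trans (le_add_of_nonneg_right (Finset.sum_nonneg fun i _ => by positivity)) (hpfeas k)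
  have hA : ∀ k i, |⟪c' i (x k), p k⟫ / (-c i (x k))| ≤ 1 := by
    intro k i
    rw [← sq_le_one_iff_abs_le_one, div_pow, neg_sq]
    have h1 := Finset.single_le_sum (f := fun i => ⟪c' i (x k), p k⟫ ^ 2 / c i (x k) ^ 2)
      (fun j _ => by positivity) (Finset.mem_univ i)
    have h2 := mul_nonneg (hD0 k) (sq_nonneg ‖p k‖)
    have h3 := hpfeas k
    simp only [hD] at h1 h2
    linarith
  have hmult : ∀ k, ∃ μ : ℝ, 0 ≤ μ ∧
      f' (x k) + L • p k + μ • (D k • p k +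
        ∑ i, (⟪c' i (x k), p k⟫ / (-c i (x k)) ^ 2) • c' i (x k)) = 0 ∧
      ⟪f' (x k), p k⟫ = -L * ‖p k‖ ^ 2 - μ := by
    intro k
    have hup : ∀ d, ⟪D k • p k + ∑ i, (⟪c' i (x k), p k⟫ / (-c i (x k)) ^ 2) • c' i (x k), d⟫ =
        D k * ⟪p k, d⟫ + ∑ i, ⟪c' i (x k), p k⟫ * ⟪c' i (x k), d⟫ / c i (x k) ^ 2 := by
      intro d
      rw [inner_add_left, real_inner_smul_left, sum_inner]
      congr 1
      refine Finset.sum_congr rfl fun i _ => ?_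
      rw [real_inner_smul_left, neg_sq]
      ring
    obtain ⟨μ, hμ, hstat, hcomp⟩ := exists_multiplier_of_min_quadratic (g := f' (x k)) (p := p k)
      (L := L)
      (u := D k • p k + ∑ i, (⟪c' i (x k), p k⟫ / (-c i (x k)) ^ 2) • c' i (x k))
      (Q := fun q => D k * ‖q‖ ^ 2 + ∑ i, ⟪c' i (x k), q⟫ ^ 2 / c i (x k) ^ 2)
      (by
        intro d t
        simp only [hup]
        rw [norm_add_sq_real, norm_smul, mul_pow, Real.norm_eq_abs, sq_abs, inner_smul_right]
        have : ∑ i, ⟪c' i (x k), p k + t • d⟫ ^ 2 / c i (x k) ^ 2 =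
            ∑ i, ⟪c' i (x k), p k⟫ ^ 2 / c i (x k) ^ 2 +
            2 * t * ∑ i, ⟪c' i (x k), p k⟫ * ⟪c' i (x k), d⟫ / c i (x k) ^ 2 +
            t ^ 2 * ∑ i, ⟪c' i (x k), d⟫ ^ 2 / c i (x k) ^ 2 := by
          rw [Finset.mul_sum, Finset.mul_sum, ← Finset.sum_add_distrib, ← Finset.sum_add_distrib]
          refine Finset.sum_congr rfl fun i _ => ?_
          rw [inner_add_right, inner_smul_right]
          ring
        rw [this]
        ring)
      (by
        rw [hup, real_inner_self_eq_norm_sq]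
        simp only [sq])
      (hpfeas k)
      (fun q hq => by
        have := hpmin k q hq
        linarith)
    refine ⟨μ, hμ, hstat, ?_⟩
    have h := congrArg (fun z => ⟪z, p k⟫) hstat
    simp only [inner_zero_left] at h
    rw [inner_add_left, inner_add_left, real_inner_smul_left, real_inner_smul_left, hup,
      real_inner_self_eq_norm_sq] at h
    simp only [← sq] at h
    rw [hcomp] at h
    linarith
  choose μ hμ hstat hgp using hmult
  have hM0 : 0 ≤ M := (norm_nonneg _).trans (hMf 0)
  obtain ⟨C₁, C₂, hC₁, hC₂, hev⟩ : ∃ C₁ C₂ : ℝ, 0 ≤ C₁ ∧ 0 ≤ C₂ ∧ ∀ᶠ k in atTop,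
      1 / √(1 + D k) ≤ C₁ * (μ k + L / 2 * ‖p k‖ ^ 2) ∧
      ∑ i, Li i / (-c i (x k)) * |⟪c' i (x k), p k⟫ / (-c i (x k))| ≤ C₂ * √(1 + D k) := by
    have hLs : 0 ≤ ∑ i, Li i := Finset.sum_nonneg fun i _ => (hLi i).le
    refine ⟨8 * L / κ ^ 2 + 2 * (1 + m * (M / σ)) / κ,
      2 * L / κ + (∑ i, Li i) * (((M + m * (M / σ) * (M ^ 2 / L)) / κ + M ^ 2 / L / σ) *
        (2 * (1 + m * (M / σ)) / κ)), by positivity, by positivity, ?_⟩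
    filter_upwards [hind, hinact] with k hk1 hk2
    obtain ⟨hres, hlam⟩ := dikin_multiplier_bounds (P := fun i => c i xstar = 0) hL (hμ k)
      (hD0 k) hκ hσ (fun i => neg_pos.2 (hneg k i).1) (hDp k) (hA k) (hstat k) (hgp k)
      hk1 (hMf k) (hMc k) hk2
    exact barrier_growth_bounds hL (hμ k) hκ (by positivity) (by positivity) hLi
      (fun i => neg_pos.2 (hneg k i).1) rfl (hDp k) (hA k) hres hlam
  have hm0 : ∀ k, 0 ≤ μ k + L / 2 * ‖p k‖ ^ 2 := fun k =>
    add_nonneg (hμ k) (by positivity)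
  have hdec : ∀ k, α k * (μ k + L / 2 * ‖p k‖ ^ 2) ≤ f (x k) - f (x (k + 1)) := by
    intro k
    have h := le_quadratic_of_lipschitz_gradient hf hflip (x k) (α k • p k)
    rw [← hstep, inner_smul_right, norm_smul, mul_pow, Real.norm_eq_abs, sq_abs, hgp] at h
    have h1 : α k ^ 2 ≤ α k := by nlinarith [hα k]
    have h2 : 0 ≤ L / 2 * ‖p k‖ ^ 2 := by positivity
    nlinarith [mul_le_mul_of_nonneg_right h1 h2]
  have hsum : Summable fun k => α k * (μ k + L / 2 * ‖p k‖ ^ 2) := by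
    refine summable_of_sum_range_le (c := f (x 0) - Fstar)
      (fun k => mul_nonneg (hα k).1.le (hm0 k)) fun K => ?_
    refine (Finset.sum_le_sum fun k _ => hdec k).trans ?_
    rw [Finset.sum_range_sub']
    linarith [hbdd (x K) fun i => (hneg K i).1.le]
  have hαlim : ∀ᶠ k in atTop, α k ≤ 1 / 4 := by
    filter_upwards [hαsq.tendsto_atTop_zero.eventually_le_const
      (u := (1 / 4 : ℝ) ^ 2) (by norm_num)] with k hk
    exact le_of_sq_le_sq hk (by norm_num)
  obtain ⟨N, hN⟩ := eventually_atTop.1 (hev.and hαlim)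
  obtain ⟨B, hB⟩ := exists_bound_of_le_mul_one_add (N := N) (E := fun k => 1 + D k)
    (ε := fun k => 2 * C₂ * C₁ * (α k * (μ k + L / 2 * ‖p k‖ ^ 2)) + α k ^ 2)
    (fun k => by linarith [hD0 k])
    (fun k => add_nonneg (mul_nonneg (by positivity) (mul_nonneg (hα k).1.le (hm0 k)))
      (sq_nonneg _))
    ((hsum.mul_left _).add hαsq)
    (by
      intro k hk
      obtain ⟨⟨h1, h2⟩, h3⟩ := hN k hk
      have hgrow : D (k + 1) ≤ D k + 2 * α k *
          ∑ i, Li i / (-c i (x k)) * |⟪c' i (x k), p k⟫ / (-c i (x k))| + α k ^ 2 * D k := by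
        simp only [hD]
        rw [Finset.mul_sum, Finset.mul_sum, ← Finset.sum_add_distrib, ← Finset.sum_add_distrib]
        refine Finset.sum_le_sum fun i _ => ((hneg k i).2 h3).trans_eq ?_
        ring
      have hr2 : √(1 + D k) * √(1 + D k) = 1 + D k := Real.mul_self_sqrt (by linarith [hD0 k])
      have hrpos : 0 < √(1 + D k) := Real.sqrt_pos.2 (by linarith [hD0 k])
      have hr : √(1 + D k) ≤ (1 + D k) * (C₁ * (μ k + L / 2 * ‖p k‖ ^ 2)) := by
        have h4 := mul_le_mul_of_nonneg_left h1 (show 0 ≤ 1 + D k by linarith [hD0 k])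
        have h5 : (1 + D k) * (1 / √(1 + D k)) = √(1 + D k) := by
          rw [mul_one_div, div_eq_iff hrpos.ne', hr2]
        linarith
      have h6 := mul_le_mul_of_nonneg_left (h2.trans (mul_le_mul_of_nonneg_left hr hC₂))
        (show 0 ≤ 2 * α k by linarith [(hα k).1])
      have h7 := sq_nonneg (α k)
      linarith)
  have hαsum : Summable α := by
    rw [← summable_nat_add_iff N]
    refine Summable.of_nonneg_of_le (fun k => (hα _).1.le) (fun k => ?_)
      (((summable_nat_add_iff N).2 hsum).mul_left (√B * C₁))
    have h1 := (hN (k + N) (Nat.le_add_left _ _)).1.1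
    have hrB : √(1 + D (k + N)) ≤ √B := Real.sqrt_le_sqrt (hB _ (Nat.le_add_left _ _))
    have hrpos : 0 < √(1 + D (k + N)) := Real.sqrt_pos.2 (by linarith [hD0 (k + N)])
    rw [div_le_iff₀ hrpos] at h1
    have hCm := mul_nonneg hC₁ (hm0 (k + N))
    have h2 := h1.trans (mul_le_mul_of_nonneg_left hrB hCm)
    have h3 := mul_le_mul_of_nonneg_left h2 (hα (k + N)).1.le
    linarith
  exact not_tendsto_nhds_of_tendsto_atTop hαdiv _ hαsum.hasSum.tendsto_sum_nat
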